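/- Let σ and n be positive integers with σ < n, and suppose a string w of length n over a totally ordered alphabet a₁ < … < a_σ of size σ attains the maximum total number of occurrences of Lyndon subsequences among all strings of length n over that alphabet. Then w is weakly increasing, i.e., w has the form a₁^{k₁} a₂^{k₂} ⋯ a_σ^{k_σ} for some nonnegative integers k₁, …, k_σ with k₁ + ⋯ + k_σ = n. -/

import Mathlib

/-- A nonempty string is a Lyndon word if it is lexicographically strictly smaller
than all of its nonempty proper suffixes. -/
def IsLyndon {α : Type*} [LinearOrder α] (w : List α) : Prop :=
  w ≠ [] ∧ ∀ i, 0 < i → i < w.length → List.Lex (· < ·) w (w.drop i)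

/-- The subsequence of `w` extracted at the set of positions `S` (taken in increasing order). -/
def subseqAt {α : Type*} (w : List α) (S : Finset (Fin w.length)) : List α :=
  (S.sort (· ≤ ·)).map w.get

/-- The total number of occurrences of Lyndon subsequences in `w`: the number of
(nonempty) sets of positions whose extracted word is a Lyndon word. -/
noncomputable def totalLyndonSubseq {α : Type*} [LinearOrder α] (w : List α) : ℕ :=
  Nat.card {S : Finset (Fin w.length) // IsLyndon (subseqAt w S)}

/-- The string a₁^{k₁} a₂^{k₂} ⋯ a_σ^{k_σ} over the alphabet Fin σ. -/
def blockString (σ : ℕ) (k : Fin σ → ℕ) : List (Fin σ) :=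
  (List.finRange σ).flatMap fun c => List.replicate (k c) c

/-- A weakly increasing word with two distinct letters is smaller than its nonempty proper
suffixes. -/
theorem lex_drop_of_pairwise_le {α : Type*} [LinearOrder α] :
    ∀ (l : List α), l.Pairwise (· ≤ ·) → (∃ x ∈ l, ∃ y ∈ l, x < y) →
      ∀ i, 0 < i → i < l.length → List.Lex (· < ·) l (l.drop i)
  | [], _, _, i, _, hil => by simp at hil
  | a :: t, hl, ⟨x, hx, y, hy, hxy⟩, i, hi, hil => by
    obtain ⟨j, rfl⟩ : ∃ j, i = j + 1 := ⟨i - 1, by omega⟩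
    have hj : j < t.length := by simpa using hil
    obtain ⟨hat, ht⟩ := List.pairwise_cons.1 hl
    have hsplit : t.drop j = t[j] :: t.drop (j + 1) := List.drop_eq_getElem_cons hj
    rw [List.drop_succ_cons, hsplit]
    rcases (hat t[j] (List.getElem_mem hj)).lt_or_eq with hlt | heq
    · exact List.Lex.rel hlt
    · have hax : a ≤ x := by
        rcases List.mem_cons.1 hx with rfl | h
        · exact le_rfl
        · exact hat x h
      have hyt : y ∈ t := by
        rcases List.mem_cons.1 hy with rfl | h
        · exact absurd hxy hax.not_gt
        · exact h
      have hay : a < y := hax.trans_lt hxy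
      rw [← heq]
      refine List.Lex.cons ?_
      refine lex_drop_of_pairwise_le t ht
        ⟨a, heq ▸ List.getElem_mem hj, y, hyt, hay⟩ (j + 1) (by omega) ?_
      by_contra hlast
      obtain ⟨m, hm, rfl⟩ := List.getElem_of_mem hyt
      have hle : t[m] ≤ t[j] := by
        rcases (show m ≤ j by omega).lt_or_eq with h | rfl
        · exact List.pairwise_iff_getElem.1 ht m j hm hj h
        · exact le_rfl
      exact absurd hay (heq ▸ hle).not_gt

theorem not_lex_replicate_of_le {α : Type*} [LinearOrder α] (a : α) :
    ∀ m k : ℕ, k ≤ m → ¬ List.Lex (· < ·) (List.replicate m a) (List.replicate k a)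
  | _, 0, _ => by simp
  | 0, k + 1, h => by omega
  | m + 1, k + 1, h => by
    rw [List.replicate_succ, List.replicate_succ]
    intro hlex
    cases hlex with
    | rel hrest => exact lt_irrefl _ hrest
    | cons hrest => exact not_lex_replicate_of_le a m k (by omega) hrest

/-- A Lyndon word is a single letter or contains two distinct letters. -/
theorem IsLyndon.length_eq_one_or_exists_ne {α : Type*} [LinearOrder α] {l : List α}
    (h : IsLyndon l) : l.length = 1 ∨ ∃ x ∈ l, ∃ y ∈ l, x ≠ y := by
  by_contra! hcon
  obtain ⟨hlen, hconst⟩ := hcon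
  obtain ⟨a, ha⟩ := List.exists_mem_of_ne_nil l h.1
  have hrep : l = List.replicate l.length a :=
    List.eq_replicate_iff.2 ⟨rfl, fun b hb => hconst b hb a ha⟩
  have hpos := List.length_pos_of_ne_nil h.1
  have hlex := h.2 1 one_pos (by omega)
  rw [hrep, List.drop_replicate] at hlex
  exact not_lex_replicate_of_le a _ _ (Nat.sub_le _ _) hlex

theorem isLyndon_of_pairwise_le {α : Type*} [LinearOrder α] {l : List α}
    (hl : l.Pairwise (· ≤ ·)) (h : l.length = 1 ∨ ∃ x ∈ l, ∃ y ∈ l, x ≠ y) :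
    IsLyndon l := by
  rcases h with h | ⟨x, hx, y, hy, hxy⟩
  · exact ⟨List.ne_nil_of_length_pos (by omega), fun i hi hil => by omega⟩
  · refine ⟨List.ne_nil_of_mem hx, lex_drop_of_pairwise_le l hl ?_⟩
    rcases hxy.lt_or_gt with h | h
    · exact ⟨x, hx, y, hy, h⟩
    · exact ⟨y, hy, x, hx, h⟩

theorem length_subseqAt {α : Type*} (w : List α) (S : Finset (Fin w.length)) :
    (subseqAt w S).length = S.card := by
  simp [subseqAt]

theorem mem_subseqAt {α : Type*} {w : List α} {S : Finset (Fin w.length)} {x : α} :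
    x ∈ subseqAt w S ↔ ∃ i ∈ S, w.get i = x := by
  simp [subseqAt]

theorem pairwise_le_subseqAt {α : Type*} [LinearOrder α] {w : List α}
    (hw : Monotone w.get) (S : Finset (Fin w.length)) :
    (subseqAt w S).Pairwise (· ≤ ·) :=
  List.Pairwise.map _ (fun _ _ h => hw h) (S.pairwise_sort (· ≤ ·))

/-- Rearranging an unsorted word in increasing order strictly increases the number of
occurrences of Lyndon subsequences. -/
theorem totalLyndonSubseq_lt_of_equiv {α : Type*} [LinearOrder α] {w u : List α}
    (e : Fin w.length ≃ Fin u.length) (he : ∀ i, u.get (e i) = w.get i)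
    (hu : Monotone u.get) (hw : ¬ Monotone w.get) :
    totalLyndonSubseq w < totalLyndonSubseq u := by
  have key (S : Finset (Fin w.length))
      (hS : S.card = 1 ∨ ∃ i ∈ S, ∃ j ∈ S, w.get i ≠ w.get j) :
      IsLyndon (subseqAt u (S.map e.toEmbedding)) := by
    refine isLyndon_of_pairwise_le (pairwise_le_subseqAt hu _) ?_
    rw [length_subseqAt, Finset.card_map]
    refine hS.imp_right ?_
    rintro ⟨i, hi, j, hj, hij⟩
    exact ⟨w.get i, mem_subseqAt.2 ⟨e i, by simpa using hi, he i⟩,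
      w.get j, mem_subseqAt.2 ⟨e j, by simpa using hj, he j⟩, hij⟩
  have hLyndon (S : Finset (Fin w.length)) (h : IsLyndon (subseqAt w S)) :
      IsLyndon (subseqAt u (S.map e.toEmbedding)) := by
    refine key S ?_
    rcases h.length_eq_one_or_exists_ne with h1 | ⟨x, hx, y, hy, hxy⟩
    · exact Or.inl (length_subseqAt w S ▸ h1)
    · obtain ⟨i, hi, rfl⟩ := mem_subseqAt.1 hx
      obtain ⟨j, hj, rfl⟩ := mem_subseqAt.1 hy
      exact Or.inr ⟨i, hi, j, hj, hxy⟩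
  obtain ⟨i, j, hij, hji⟩ : ∃ i j, i ≤ j ∧ w.get j < w.get i := by
    simpa [Monotone] using hw
  have hlt : i < j := hij.lt_of_ne (by rintro rfl; exact lt_irrefl _ hji)
  have hbad : ¬ IsLyndon (subseqAt w {i, j}) := by
    have hsort : ({i, j} : Finset (Fin w.length)).sort (· ≤ ·) = [i, j] := by
      rw [Finset.sort_insert (· ≤ ·) (by simpa using hij) (by simpa using hlt.ne)]
      simp
    rintro ⟨-, h⟩
    have h1 := h 1 one_pos (by simp [subseqAt, hsort])
    simp only [subseqAt, hsort, List.map_cons, List.map_nil, List.drop_succ_cons,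
      List.drop_zero, List.cons_lex_cons_iff] at h1
    rcases h1 with hrest | ⟨hrest, -⟩
    · exact lt_asymm hrest hji
    · exact hji.ne hrest.symm
  have hgood : IsLyndon (subseqAt u (({i, j} : Finset (Fin w.length)).map e.toEmbedding)) :=
    key _ (Or.inr ⟨i, by simp, j, by simp, hji.ne'⟩)
  unfold totalLyndonSubseq
  let f : {S : Finset (Fin w.length) // IsLyndon (subseqAt w S)} →
      {S : Finset (Fin u.length) // IsLyndon (subseqAt u S)} :=
    fun S => ⟨S.1.map e.toEmbedding, hLyndon S.1 S.2⟩
  have hf : Function.Injective f := fun S T h =>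
    Subtype.ext (Finset.map_injective e.toEmbedding (congrArg Subtype.val h))
  refine (Nat.card_le_card_of_injective f hf).lt_of_ne fun hcard => ?_
  obtain ⟨S, hS⟩ := ((Nat.bijective_iff_injective_and_card f).2 ⟨hf, hcard⟩).2 ⟨_, hgood⟩
  have hSij : S.1 = {i, j} :=
    Finset.map_injective e.toEmbedding (congrArg Subtype.val hS)
  exact hbad (hSij ▸ S.2)

theorem exists_monotone_rearrangement {α : Type*} [LinearOrder α] (w : List α) :
    ∃ (u : List α) (e : Fin w.length ≃ Fin u.length), u.length = w.length ∧
      (∀ i, u.get (e i) = w.get i) ∧ Monotone u.get := by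
  refine ⟨List.ofFn (w.get ∘ Tuple.sort w.get),
    (Tuple.sort w.get).symm.trans (finCongr (List.length_ofFn).symm), List.length_ofFn,
    fun i => ?_, fun i j hij => ?_⟩
  · simp
  · rw [List.get_ofFn, List.get_ofFn]
    exact Tuple.monotone_sort w.get (by simpa using hij)

theorem pairwise_le_blockString (σ : ℕ) (k : Fin σ → ℕ) :
    (blockString σ k).Pairwise (· ≤ ·) := by
  rw [blockString, List.pairwise_flatMap]
  refine ⟨fun a _ => List.pairwise_replicate.2 (Or.inr le_rfl), ?_⟩
  refine (List.pairwise_lt_finRange σ).imp fun {a b} hab x hx y hy => ?_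
  rw [List.eq_of_mem_replicate hx, List.eq_of_mem_replicate hy]
  exact hab.le

theorem count_blockString (σ : ℕ) (k : Fin σ → ℕ) (c : Fin σ) :
    (blockString σ k).count c = k c := by
  rw [blockString, List.count_flatMap, ← Fin.sum_univ_def]
  simp [List.count_replicate]

theorem eq_blockString_of_pairwise_le {σ : ℕ} {w : List (Fin σ)}
    (hw : w.Pairwise (· ≤ ·)) : w = blockString σ fun c => w.count c := by
  refine List.Perm.eq_of_pairwise (fun _ _ _ _ => le_antisymm) hw
    (pairwise_le_blockString σ _) (List.perm_iff_count.2 fun c => ?_)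
  rw [count_blockString]

theorem maximizer_is_weakly_increasing (σ n : ℕ) (hσ : 0 < σ) (hσn : σ < n)
    (w : List (Fin σ)) (hw : w.length = n)
    (hmax : ∀ u : List (Fin σ), u.length = n →
      totalLyndonSubseq u ≤ totalLyndonSubseq w) :
    ∃ k : Fin σ → ℕ, (∑ i, k i) = n ∧ w = blockString σ k := by
  have hmono : Monotone w.get := by
    by_contra hnot
    obtain ⟨u, e, hlen, he, hu⟩ := exists_monotone_rearrangement w
    exact (totalLyndonSubseq_lt_of_equiv e he hu hnot).not_ge (hmax u (hlen.trans hw))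
  refine ⟨fun c => w.count c, ?_, eq_blockString_of_pairwise_le ?_⟩
  · rw [← hw]
    simpa using Multiset.sum_count_eq_card (s := Finset.univ) (m := (w : Multiset (Fin σ)))
      (by simp)
  · exact List.pairwise_iff_get.2 fun i j hij => hmono hij.le
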